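/- Let u₀, v₀ : ℝ × ℝ → ℝ be C^∞ functions of (t,x). Set Δ₀¹ = u₀_t − (1/2) u₀_{xx} + u₀ v₀ u₀_x + (1/2) u₀² v₀_x. Then the pointwise identity Δ₀¹ = ∂_t[ (t u₀ v₀ − x) u₀_x + (1/2) t u₀² v₀_x ] + ∂_x[ −(t u₀ v₀ − x) u₀_t − (1/2) t u₀² v₀_t − (1/2) u₀_x ] holds. -/

import Mathlib

noncomputable def pt (f : ℝ × ℝ → ℝ) : ℝ × ℝ → ℝ := fun p => deriv (fun s => f (s, p.2)) p.1
noncomputable def px (f : ℝ × ℝ → ℝ) : ℝ × ℝ → ℝ := fun p => deriv (fun y => f (p.1, y)) p.2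

theorem hasDerivAt_slice_fst {f : ℝ × ℝ → ℝ} (hf : Differentiable ℝ f) (p : ℝ × ℝ) :
    HasDerivAt (fun s => f (s, p.2)) (fderiv ℝ f p (1, 0)) p.1 :=
  (hf p).hasFDerivAt.comp_hasDerivAt (f := fun s : ℝ => (s, p.2)) p.1
    ((hasDerivAt_id p.1).prodMk (hasDerivAt_const p.1 p.2))

theorem hasDerivAt_slice_snd {f : ℝ × ℝ → ℝ} (hf : Differentiable ℝ f) (p : ℝ × ℝ) :
    HasDerivAt (fun y => f (p.1, y)) (fderiv ℝ f p (0, 1)) p.2 :=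
  (hf p).hasFDerivAt.comp_hasDerivAt (f := fun y : ℝ => (p.1, y)) p.2
    ((hasDerivAt_const p.2 p.1).prodMk (hasDerivAt_id p.2))

theorem pt_eq_fderiv {f : ℝ × ℝ → ℝ} (hf : Differentiable ℝ f) :
    pt f = fun p => fderiv ℝ f p (1, 0) :=
  funext fun p => (hasDerivAt_slice_fst hf p).deriv

theorem px_eq_fderiv {f : ℝ × ℝ → ℝ} (hf : Differentiable ℝ f) :
    px f = fun p => fderiv ℝ f p (0, 1) :=
  funext fun p => (hasDerivAt_slice_snd hf p).deriv

theorem hasDerivAt_pt {f : ℝ × ℝ → ℝ} (hf : Differentiable ℝ f) (p : ℝ × ℝ) :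
    HasDerivAt (fun s => f (s, p.2)) (pt f p) p.1 :=
  (hasDerivAt_slice_fst hf p).differentiableAt.hasDerivAt

theorem hasDerivAt_px {f : ℝ × ℝ → ℝ} (hf : Differentiable ℝ f) (p : ℝ × ℝ) :
    HasDerivAt (fun y => f (p.1, y)) (px f p) p.2 :=
  (hasDerivAt_slice_snd hf p).differentiableAt.hasDerivAt

theorem differentiable_fderiv_apply {f : ℝ × ℝ → ℝ} (hf : ContDiff ℝ 2 f) (w : ℝ × ℝ) :
    Differentiable ℝ fun p => fderiv ℝ f p w :=
  ((hf.fderiv_right (m := 1) (by norm_num)).differentiable (by norm_num)).clm_apply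
    (differentiable_const w)

theorem differentiable_pt {f : ℝ × ℝ → ℝ} (hf : ContDiff ℝ 2 f) : Differentiable ℝ (pt f) := by
  rw [pt_eq_fderiv (hf.differentiable (by norm_num))]
  exact differentiable_fderiv_apply hf _

theorem differentiable_px {f : ℝ × ℝ → ℝ} (hf : ContDiff ℝ 2 f) : Differentiable ℝ (px f) := by
  rw [px_eq_fderiv (hf.differentiable (by norm_num))]
  exact differentiable_fderiv_apply hf _

theorem pt_px_comm {f : ℝ × ℝ → ℝ} (hf : ContDiff ℝ 2 f) (p : ℝ × ℝ) :
    pt (px f) p = px (pt f) p := by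
  have hd : Differentiable ℝ (fderiv ℝ f) :=
    (hf.fderiv_right (m := 1) (by norm_num)).differentiable (by norm_num)
  have happ (v w : ℝ × ℝ) :
      fderiv ℝ (fun q => fderiv ℝ f q v) p w = fderiv ℝ (fderiv ℝ f) p w v := by
    rw [fderiv_clm_apply (hd p) (differentiableAt_const v)]
    simp
  have hsymm : IsSymmSndFDerivAt ℝ f p := hf.contDiffAt.isSymmSndFDerivAt (by simp)
  rw [pt_eq_fderiv (differentiable_px hf), px_eq_fderiv (differentiable_pt hf),
    pt_eq_fderiv (hf.differentiable (by norm_num)), px_eq_fderiv (hf.differentiable (by norm_num))]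
  simp only [happ]
  exact hsymm _ _

theorem stmt17 (u₀ v₀ : ℝ × ℝ → ℝ)
    (hu₀ : ContDiff ℝ (⊤ : ℕ∞) u₀) (hv₀ : ContDiff ℝ (⊤ : ℕ∞) v₀) :
    ∀ p : ℝ × ℝ,
      pt u₀ p - (1 / 2) * px (px u₀) p + u₀ p * v₀ p * px u₀ p
        + (1 / 2) * (u₀ p) ^ 2 * px v₀ p =
      pt (fun q => (q.1 * u₀ q * v₀ q - q.2) * px u₀ q
          + (1 / 2) * q.1 * (u₀ q) ^ 2 * px v₀ q) p
      + px (fun q => -(q.1 * u₀ q * v₀ q - q.2) * pt u₀ q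
          - (1 / 2) * q.1 * (u₀ q) ^ 2 * pt v₀ q - (1 / 2) * px u₀ q) p := by
  intro p
  have hu : ContDiff ℝ 2 u₀ := contDiff_infty.mp hu₀ 2
  have hv : ContDiff ℝ 2 v₀ := contDiff_infty.mp hv₀ 2
  have du := hu.differentiable (by norm_num)
  have dv := hv.differentiable (by norm_num)
  have ht := (((((hasDerivAt_id p.1).mul (hasDerivAt_pt du p)).mul
    (hasDerivAt_pt dv p)).sub_const p.2).mul (hasDerivAt_pt (differentiable_px hu) p)).add
    ((((hasDerivAt_id p.1).const_mul (1 / 2 : ℝ)).mul ((hasDerivAt_pt du p).pow 2)).mul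
      (hasDerivAt_pt (differentiable_px hv) p))
  have hx := ((((((hasDerivAt_px du p).const_mul p.1).mul
    (hasDerivAt_px dv p)).sub (hasDerivAt_id p.2)).neg.mul
      (hasDerivAt_px (differentiable_pt hu) p)).sub
    ((((hasDerivAt_px du p).pow 2).const_mul (1 / 2 * p.1)).mul
      (hasDerivAt_px (differentiable_pt hv) p))).sub
    ((hasDerivAt_px (differentiable_px hu) p).const_mul (1 / 2 : ℝ))
  have et : pt (fun q => (q.1 * u₀ q * v₀ q - q.2) * px u₀ q
      + (1 / 2) * q.1 * (u₀ q) ^ 2 * px v₀ q) p = _ := ht.deriv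
  have ex : px (fun q => -(q.1 * u₀ q * v₀ q - q.2) * pt u₀ q
      - (1 / 2) * q.1 * (u₀ q) ^ 2 * pt v₀ q - (1 / 2) * px u₀ q) p = _ := hx.deriv
  rw [et, ex, pt_px_comm hu, pt_px_comm hv]
  simp
  ring
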